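/- (Left properness of the Kan–Quillen model structure) Given a pushout square of simplicial sets in which i : A → B is a monomorphism and f : A → X is a weak homotopy equivalence, the induced map B → X ⊔_A B is a weak homotopy equivalence. -/

import Mathlib

open CategoryTheory CategoryTheory.Limits Simplicial MonoidalCategory SSet

noncomputable instance : MonoidalClosed SSet.{0} :=
  (inferInstance : MonoidalClosed (SimplexCategoryᵒᵖ ⥤ Type 0))

namespace Paper

/-- A map of simplicial sets is a *trivial fibration* if it has the right lifting
property with respect to all boundary inclusions `∂Δ[n] ⟶ Δ[n]` for `n ≥ 0`. -/
def TrivialFibration {X Y : SSet.{0}} (p : X ⟶ Y) : Prop :=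
  ∀ n : ℕ, HasLiftingProperty (SSet.boundary n).ι p

/-- A map of simplicial sets is a *Kan fibration* if it has the right lifting property
with respect to all horn inclusions `Λ[n, i] ⟶ Δ[n]` for `n ≥ 1`, `0 ≤ i ≤ n`. -/
def KanFibration {X Y : SSet.{0}} (p : X ⟶ Y) : Prop :=
  ∀ (n : ℕ) (i : Fin (n + 2)), HasLiftingProperty (SSet.horn (n + 1) i).ι p

/-- An *anodyne* map is one with the left lifting property with respect to
all Kan fibrations. -/
def Anodyne {A B : SSet.{0}} (i : A ⟶ B) : Prop :=
  ∀ ⦃X Y : SSet.{0}⦄ (p : X ⟶ Y), KanFibration p → HasLiftingProperty i p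

/-- The unique map to `Δ[0]`. -/
def toPt (X : SSet.{0}) : X ⟶ Δ[0] where
  app m := ↾fun _ => SSet.stdSimplex.const 0 0 m
  naturality := by
    intro m m' φ
    refine ConcreteCategory.hom_ext _ _ (fun x => ?_)
    apply stdSimplex.objEquiv.injective
    apply SimplexCategory.Hom.ext
    apply OrderHom.ext
    funext j
    exact @Subsingleton.elim (Fin 1) _ _ _

/-- A *Kan complex* is a simplicial set whose map to `Δ[0]` is a Kan fibration. -/
def KanComplex (X : SSet.{0}) : Prop :=
  KanFibration (toPt X)

/-- The constant map at the vertex `k` of `Δ[1]`. -/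
def cst (X : SSet.{0}) (k : Fin 2) : X ⟶ Δ[1] where
  app m := ↾fun _ => SSet.stdSimplex.const 1 k m
  naturality := by
    intro m m' φ
    refine ConcreteCategory.hom_ext _ _ (fun x => ?_)
    apply stdSimplex.objEquiv.injective
    apply SimplexCategory.Hom.ext
    ext j
    rfl

/-- The endpoint inclusion `X ⟶ X ⊗ Δ[1]` at the vertex `k` of `Δ[1]`. -/
noncomputable def ept (X : SSet.{0}) (k : Fin 2) : X ⟶ X ⊗ Δ[1] :=
  CartesianMonoidalCategory.lift (𝟙 X) (cst X k)

/-- A (single-step) homotopy from `f` to `g`, as a property of the pair `(f, g)`. -/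
def Homotopy {X Y : SSet.{0}} (f g : X ⟶ Y) : Prop :=
  ∃ H : X ⊗ Δ[1] ⟶ Y, ept X 0 ≫ H = f ∧ ept X 1 ≫ H = g

/-- `f` and `g` are *homotopic* if they are connected by a zig-zag of homotopies. -/
def Homotopic {X Y : SSet.{0}} (f g : X ⟶ Y) : Prop :=
  Relation.EqvGen Homotopy f g

/-- A *homotopy equivalence* of simplicial sets. -/
def HomotopyEquivalence {X Y : SSet.{0}} (f : X ⟶ Y) : Prop :=
  ∃ g : Y ⟶ X, Homotopic (f ≫ g) (𝟙 X) ∧ Homotopic (g ≫ f) (𝟙 Y)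

/-- A map `f : X ⟶ Y` is a *weak homotopy equivalence* if for every Kan complex `K`
the induced map `K^Y ⟶ K^X` on exponentials is a homotopy equivalence. -/
def WeakHomotopyEquivalence {X Y : SSet.{0}} (f : X ⟶ Y) : Prop :=
  ∀ K : SSet.{0}, KanComplex K → HomotopyEquivalence ((MonoidalClosed.pre f).app K)

/-- A homotopy `H` between maps over `B` which is *fiberwise over `B`*. -/
def FibHomotopy {B X Y : SSet.{0}} (pX : X ⟶ B) (pY : Y ⟶ B) (f g : X ⟶ Y) : Prop :=
  ∃ H : X ⊗ Δ[1] ⟶ Y, ept X 0 ≫ H = f ∧ ept X 1 ≫ H = g ∧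
    H ≫ pY = CartesianMonoidalCategory.fst X Δ[1] ≫ pX

/-- Connectedness by a zig-zag of fiberwise homotopies over `B`. -/
def FibHomotopic {B X Y : SSet.{0}} (pX : X ⟶ B) (pY : Y ⟶ B) (f g : X ⟶ Y) : Prop :=
  Relation.EqvGen (FibHomotopy pX pY) f g

/-- A *fiberwise homotopy equivalence over `B`*. -/
def FibHomotopyEquivalence {B X Y : SSet.{0}} (pX : X ⟶ B) (pY : Y ⟶ B) (f : X ⟶ Y) : Prop :=
  f ≫ pY = pX ∧ ∃ g : Y ⟶ X, g ≫ pX = pY ∧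
    FibHomotopic pX pX (f ≫ g) (𝟙 X) ∧ FibHomotopic pY pY (g ≫ f) (𝟙 Y)

end Paper

namespace Paper
open HomotopicalAlgebra modelCategoryQuillen

lemma kanFibration_iff {X Y : SSet.{0}} (p : X ⟶ Y) : KanFibration p ↔ Fibration p := by
  refine ⟨fun h => ?_, fun _ n i => inferInstance⟩
  rw [modelCategoryQuillen.fibration_iff]
  intro _ _ _ hj
  simp only [J, MorphismProperty.iSup_iff] at hj
  obtain ⟨n, ⟨i⟩⟩ := hj
  exact h n i

lemma KanComplex.isFibrant {K : SSet.{0}} (hK : KanComplex K) : SSet.KanComplex K := by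
  have := (kanFibration_iff _).1 hK
  exact (isFibrant_iff_of_isTerminal (toPt K) stdSimplex.isTerminalObj₀).2 this

lemma KanFibration.of_isPullback {E B E' B' : SSet.{0}} {t : E' ⟶ E} {l : E' ⟶ B'} {p : E ⟶ B}
    {u : B' ⟶ B} (sq : IsPullback t l p u) (hp : KanFibration p) : KanFibration l :=
  fun n i => by have := hp n i; exact sq.hasLiftingProperty _

lemma ept_fst (X : SSet.{0}) (k : Fin 2) :
    ept X k ≫ CartesianMonoidalCategory.fst X Δ[1] = 𝟙 X := rfl

lemma ept_whiskerRight {X Y : SSet.{0}} (h : X ⟶ Y) (k : Fin 2) :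
    ept X k ≫ h ▷ Δ[1] = h ≫ ept Y k := rfl

lemma stdSimplex_ext {n : ℕ} {m : SimplexCategoryᵒᵖ} {x y : (Δ[n] : SSet.{0}).obj m}
    (h : ∀ j, stdSimplex.asOrderHom x j = stdSimplex.asOrderHom y j) : x = y :=
  stdSimplex.objEquiv.injective (SimplexCategory.Hom.ext _ _ (OrderHom.ext _ _ (funext h)))

lemma asOrderHom_const {n : ℕ} (k : Fin (n + 1)) (m : SimplexCategoryᵒᵖ)
    (j : Fin (m.unop.len + 1)) :
    stdSimplex.asOrderHom (stdSimplex.const.{0} n k m) j = k := rfl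

lemma mem_horn_one_iff {k : Fin 2} {m : SimplexCategoryᵒᵖ} (s : (Δ[1] : SSet.{0}).obj m) :
    s ∈ (Λ[1, k] : Subcomplex _).obj m ↔ s = stdSimplex.const 1 k m := by
  rw [SSet.mem_horn_iff, Set.ne_univ_iff_exists_notMem]
  constructor
  · rintro ⟨l, hl⟩
    refine stdSimplex_ext fun j => ?_
    rw [asOrderHom_const]
    have hj : stdSimplex.asOrderHom s j ≠ l := fun h => hl (Or.inl ⟨j, h⟩)
    have hk : l ≠ k := fun h => hl (Or.inr h)
    omega
  · rintro rfl
    refine ⟨k.rev, ?_⟩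
    rintro (⟨j, hj⟩ | hk)
    · rw [asOrderHom_const] at hj
      revert hj; fin_cases k <;> decide
    · revert hk; fin_cases k <;> simp

lemma hasLiftingProperty_ept (P : SSet.{0}) (k : Fin 2) {E B : SSet.{0}} {p : E ⟶ B}
    (hp : KanFibration p) : HasLiftingProperty (ept P k) p where
  sq_hasLift {u v} sq := by
    have h := (anodyneExtensions.horn_ι (n := 1) k).whiskerLeft P p
      (by rw [kanFibration_iff] at hp; exact (HomotopicalAlgebra.fibration_iff p).1 hp)
    have e : CartesianMonoidalCategory.fst P (Λ[1, k] : SSet) ≫ ept P k = P ◁ Λ[1, k].ι := by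
      apply NatTrans.ext
      funext m
      ext ⟨x, s⟩
      exact Prod.ext rfl ((mem_horn_one_iff _).1 s.2).symm
    have sq' : CommSq (CartesianMonoidalCategory.fst P (Λ[1, k] : SSet) ≫ u) (P ◁ Λ[1, k].ι) p v :=
      ⟨by rw [Category.assoc, sq.w, reassoc_of% e]⟩
    let c : P ⟶ (Λ[1, k] : SSet) := Subcomplex.lift (cst P k) (by
      rintro m _ ⟨x, rfl⟩
      exact (mem_horn_one_iff _).2 rfl)
    have hc : CartesianMonoidalCategory.lift (𝟙 P) c ≫ P ◁ Λ[1, k].ι = ept P k := rfl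
    exact ⟨⟨{ l := sq'.lift
              fac_left := by rw [← hc, Category.assoc, sq'.fac_left]; rfl
              fac_right := sq'.fac_right }⟩⟩

/-- The map `Δ[1] ⊗ Δ[1] ⟶ Δ[1]` given on simplices by a monotone binary operation on `Fin 2`. -/
def stdSimplexOneMap (φ : Fin 2 × Fin 2 →o Fin 2) : (Δ[1] ⊗ Δ[1] : SSet.{0}) ⟶ Δ[1] where
  app _ := ↾fun x => stdSimplex.objMk
    (φ.comp ((stdSimplex.asOrderHom x.1).prod (stdSimplex.asOrderHom x.2)))
  naturality _ _ _ := rfl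

lemma exists_contraction (k : Fin 2) : ∃ c : (Δ[1] ⊗ Δ[1] : SSet.{0}) ⟶ Δ[1],
    ept Δ[1] k ≫ c = cst Δ[1] k ∧ ept Δ[1] k.rev ≫ c = 𝟙 _ ∧
    CartesianMonoidalCategory.lift (cst Δ[1] k) (𝟙 Δ[1]) ≫ c = cst Δ[1] k := by
  obtain ⟨φ, h₁, h₂, h₃⟩ : ∃ φ : Fin 2 × Fin 2 →o Fin 2,
      (∀ s, φ (s, k) = k) ∧ (∀ s, φ (s, k.rev) = s) ∧ ∀ t, φ (k, t) = k := by
    fin_cases k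
    · exact ⟨⟨fun x => x.1 ⊓ x.2, fun _ _ h => inf_le_inf h.1 h.2⟩,
        by decide, by decide, by decide⟩
    · exact ⟨⟨fun x => x.1 ⊔ x.2, fun _ _ h => sup_le_sup h.1 h.2⟩,
        by decide, by decide, by decide⟩
  refine ⟨stdSimplexOneMap φ, ?_, ?_, ?_⟩ <;> apply NatTrans.ext <;> funext m <;> ext x <;>
    refine stdSimplex_ext fun j => ?_
  · exact h₁ _
  · exact h₂ _
  · exact h₃ _

lemma Homotopy.comp_right {X Y Z : SSet.{0}} {f g : X ⟶ Y} (h : Homotopy f g) (u : Y ⟶ Z) :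
    Homotopy (f ≫ u) (g ≫ u) := by
  obtain ⟨H, rfl, rfl⟩ := h
  exact ⟨H ≫ u, rfl, rfl⟩

lemma Homotopy.comp_left {X Y Z : SSet.{0}} {f g : Y ⟶ Z} (h : Homotopy f g) (u : X ⟶ Y) :
    Homotopy (u ≫ f) (u ≫ g) := by
  obtain ⟨H, rfl, rfl⟩ := h
  exact ⟨u ▷ Δ[1] ≫ H, rfl, rfl⟩

lemma homotopic_of_ept {X Y : SSet.{0}} (H : X ⊗ Δ[1] ⟶ Y) (k l : Fin 2) :
    Homotopic (ept X k ≫ H) (ept X l ≫ H) := by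
  have h : Homotopic (ept X 0 ≫ H) (ept X 1 ≫ H) := .rel _ _ ⟨H, rfl, rfl⟩
  fin_cases k <;> fin_cases l
  · exact .refl _
  · exact h
  · exact h.symm
  · exact .refl _

/-- The homotopy relation, as a relation on morphisms of simplicial sets. -/
def homotopicRel : HomRel SSet.{0} := fun _ _ f g => Homotopic f g

instance : Congruence homotopicRel where
  comp_left u _ _ h := by
    induction h with
    | rel _ _ h => exact .rel _ _ (h.comp_left u)
    | refl _ => exact .refl _
    | symm _ _ _ h => exact h.symm
    | trans _ _ _ _ _ h h' => exact h.trans _ _ _ h'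
  comp_right u h := by
    induction h with
    | rel _ _ h => exact .rel _ _ (h.comp_right u)
    | refl _ => exact .refl _
    | symm _ _ _ h => exact h.symm
    | trans _ _ _ _ _ h h' => exact h.trans _ _ _ h'
  equivalence := Relation.EqvGen.is_equivalence _

/-- The functor from simplicial sets to the naive homotopy category. -/
abbrev toHo : SSet.{0} ⥤ Quotient homotopicRel := Quotient.functor _

lemma toHo_map_eq_iff {X Y : SSet.{0}} (f g : X ⟶ Y) :
    toHo.map f = toHo.map g ↔ Homotopic f g :=
  Quotient.functor_map_eq_iff _ _ _

lemma homotopyEquivalence_iff_isIso {X Y : SSet.{0}} (f : X ⟶ Y) :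
    HomotopyEquivalence f ↔ IsIso (toHo.map f) := by
  constructor
  · rintro ⟨g, h₁, h₂⟩
    refine ⟨toHo.map g, ?_, ?_⟩
    · rwa [← toHo.map_comp, ← toHo.map_id, toHo_map_eq_iff]
    · rwa [← toHo.map_comp, ← toHo.map_id, toHo_map_eq_iff]
  · rintro ⟨g, h₁, h₂⟩
    obtain ⟨g, rfl⟩ := toHo.map_surjective g
    rw [← toHo.map_comp, ← toHo.map_id, toHo_map_eq_iff] at h₁ h₂
    exact ⟨g, h₁, h₂⟩

lemma isIso_of_isIso_comp_comp {C : Type*} [Category* C] {W X Y Z : C} (f : W ⟶ X) (g : X ⟶ Y)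
    (h : Y ⟶ Z) [IsIso (f ≫ g)] [IsIso (g ≫ h)] : IsIso g := by
  have : IsSplitEpi g := ⟨⟨⟨inv (f ≫ g) ≫ f, by simp⟩⟩⟩
  have : Mono g := mono_of_mono g h
  exact isIso_of_mono_of_isSplitEpi g

open CartesianMonoidalCategory in
/-- The cylinder `Y ⊗ Δ[1]` deformation retracts onto each of its ends. -/
lemma exists_cylinder_contraction (Y : SSet.{0}) (k : Fin 2) :
    ∃ C : (Y ⊗ Δ[1]) ⊗ Δ[1] ⟶ Y ⊗ Δ[1],
      ept (Y ⊗ Δ[1]) k ≫ C = fst _ _ ≫ ept Y k ∧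
      ept (Y ⊗ Δ[1]) k.rev ≫ C = 𝟙 _ ∧
      ept Y k ▷ Δ[1] ≫ C = fst _ _ ≫ ept Y k := by
  obtain ⟨c, hc₁, hc₂, hc₃⟩ := exists_contraction k
  have h (l : Fin 2) : ept (Y ⊗ Δ[1]) l ≫ (α_ Y Δ[1] Δ[1]).hom = Y ◁ ept Δ[1] l := rfl
  have h' : ept Y k ▷ Δ[1] ≫ (α_ Y Δ[1] Δ[1]).hom = Y ◁ lift (cst Δ[1] k) (𝟙 Δ[1]) := rfl
  refine ⟨(α_ Y Δ[1] Δ[1]).hom ≫ Y ◁ c, ?_, ?_, ?_⟩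
  · rw [reassoc_of% h, ← MonoidalCategory.whiskerLeft_comp, hc₁]
    rfl
  · rw [reassoc_of% h, ← MonoidalCategory.whiskerLeft_comp, hc₂, MonoidalCategory.whiskerLeft_id]
  · rw [reassoc_of% h', ← MonoidalCategory.whiskerLeft_comp, hc₃]
    rfl

open CartesianMonoidalCategory in
/-- The pullback of an endpoint inclusion along a Kan fibration is a homotopy equivalence. -/
lemma homotopyEquivalence_of_isPullback_ept {P Q Y : SSet.{0}} {j : Q ⟶ P} {q : Q ⟶ Y}
    {p : P ⟶ Y ⊗ Δ[1]} {k : Fin 2} (sq : IsPullback j q p (ept Y k)) (hp : KanFibration p) :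
    HomotopyEquivalence j := by
  obtain ⟨C, hC₁, hC₂, hC₃⟩ := exists_cylinder_contraction Y k
  have := hasLiftingProperty_ept P k.rev hp
  have sqL : CommSq (𝟙 P) (ept P k.rev) p (p ▷ Δ[1] ≫ C) :=
    ⟨by rw [reassoc_of% ept_whiskerRight, hC₂, Category.id_comp, Category.comp_id]⟩
  let r : P ⟶ Q := sq.lift (ept P k ≫ sqL.lift) (p ≫ fst _ _) (by
    rw [Category.assoc, sqL.fac_right, reassoc_of% ept_whiskerRight, hC₁, Category.assoc])
  let R : Q ⊗ Δ[1] ⟶ Q := sq.lift (j ▷ Δ[1] ≫ sqL.lift) (fst _ _ ≫ q) (by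
    rw [Category.assoc, sqL.fac_right, ← MonoidalCategory.comp_whiskerRight_assoc, sq.w,
      MonoidalCategory.comp_whiskerRight_assoc, hC₃, Category.assoc]
    rfl)
  have hR₁ : ept Q k ≫ R = j ≫ r := by
    apply sq.hom_ext
    · simp only [R, r, Category.assoc, sq.lift_fst, reassoc_of% ept_whiskerRight]
    · simp only [R, r, Category.assoc, sq.lift_snd, reassoc_of% ept_fst]
      rw [reassoc_of% sq.w, ept_fst, Category.comp_id]
  have hR₂ : ept Q k.rev ≫ R = 𝟙 Q := by
    apply sq.hom_ext
    · simp only [R, Category.assoc, sq.lift_fst, reassoc_of% ept_whiskerRight, sqL.fac_left,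
        Category.comp_id, Category.id_comp]
    · simp only [R, Category.assoc, sq.lift_snd, reassoc_of% ept_fst, Category.id_comp]
  refine ⟨r, ?_, ?_⟩
  · rw [← hR₁, ← hR₂]
    exact homotopic_of_ept _ _ _
  · rw [← sqL.fac_left, show r ≫ j = _ from sq.lift_fst _ _ _]
    exact homotopic_of_ept _ _ _

lemma homotopyEquivalence_fst_ept_comp_iff {E B Y : SSet.{0}} {p : E ⟶ B} (hp : KanFibration p)
    (H : Y ⊗ Δ[1] ⟶ B) (k : Fin 2) :
    HomotopyEquivalence (pullback.fst p (ept Y k ≫ H)) ↔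
      HomotopyEquivalence (pullback.fst p H) := by
  have sqH := IsPullback.of_hasPullback p H
  have sqk := IsPullback.of_hasPullback p (ept Y k ≫ H)
  let j := sqH.lift (pullback.fst p (ept Y k ≫ H)) (pullback.snd _ _ ≫ ept Y k)
    (by rw [sqk.w, Category.assoc])
  have hj : j ≫ pullback.fst p H = pullback.fst p (ept Y k ≫ H) := sqH.lift_fst _ _ _
  have sqj : IsPullback j (pullback.snd _ _) (pullback.snd p H) (ept Y k) :=
    .of_right (by rw [hj]; exact sqk) (sqH.lift_snd _ _ _) sqH
  have := (homotopyEquivalence_iff_isIso _).1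
    (homotopyEquivalence_of_isPullback_ept sqj (hp.of_isPullback sqH))
  rw [homotopyEquivalence_iff_isIso, homotopyEquivalence_iff_isIso, ← hj, toHo.map_comp]
  exact isIso_comp_left_iff _ _

lemma homotopyEquivalence_fst_iff_of_homotopic {E B Y : SSet.{0}} {p : E ⟶ B}
    (hp : KanFibration p) {u v : Y ⟶ B} (h : Homotopic u v) :
    HomotopyEquivalence (pullback.fst p u) ↔ HomotopyEquivalence (pullback.fst p v) := by
  induction h with
  | rel _ _ h =>
    obtain ⟨H, rfl, rfl⟩ := h
    rw [homotopyEquivalence_fst_ept_comp_iff hp, homotopyEquivalence_fst_ept_comp_iff hp]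
  | refl _ => rfl
  | symm _ _ _ h => exact h.symm
  | trans _ _ _ _ _ h h' => exact h.trans h'

lemma homotopyEquivalence_of_isIso {X Y : SSet.{0}} (f : X ⟶ Y) [IsIso f] :
    HomotopyEquivalence f :=
  (homotopyEquivalence_iff_isIso f).2 inferInstance

/-- Any pullback of a Kan fibration along a map homotopic to the identity projects to the
total space by a homotopy equivalence. -/
lemma homotopyEquivalence_of_isPullback_of_homotopic_id {E E' B : SSet.{0}} {t : E' ⟶ E}
    {l : E' ⟶ B} {p : E ⟶ B} {u : B ⟶ B} (sq : IsPullback t l p u) (hp : KanFibration p)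
    (hu : Homotopic u (𝟙 B)) : HomotopyEquivalence t := by
  have h := (homotopyEquivalence_fst_iff_of_homotopic hp hu).2 (homotopyEquivalence_of_isIso _)
  rw [homotopyEquivalence_iff_isIso] at h ⊢
  rw [← sq.isoPullback_hom_fst, toHo.map_comp]
  infer_instance

/-- The pullback of a homotopy equivalence along a Kan fibration is a homotopy equivalence. -/
lemma HomotopyEquivalence.of_isPullback {E E' B Y : SSet.{0}} {t : E' ⟶ E} {l : E' ⟶ Y}
    {p : E ⟶ B} {u : Y ⟶ B} (sq : IsPullback t l p u) (hp : KanFibration p)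
    (hu : HomotopyEquivalence u) : HomotopyEquivalence t := by
  obtain ⟨g, hug, hgu⟩ := hu
  have hl := hp.of_isPullback sq
  have sq₁ := IsPullback.of_hasPullback l g
  have sq₂ := IsPullback.of_hasPullback (pullback.snd l g) u
  have h₁ := homotopyEquivalence_of_isPullback_of_homotopic_id (sq₁.paste_horiz sq) hp hgu
  have h₂ := homotopyEquivalence_of_isPullback_of_homotopic_id (sq₂.paste_horiz sq₁) hl hug
  rw [homotopyEquivalence_iff_isIso, toHo.map_comp] at h₁ h₂
  have := isIso_of_isIso_comp_comp (toHo.map (pullback.fst (pullback.snd l g) u))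
    (toHo.map (pullback.fst l g)) (toHo.map t)
  rw [homotopyEquivalence_iff_isIso]
  exact IsIso.of_isIso_comp_left (toHo.map (pullback.fst l g)) _

/-- The internal hom into a fixed object sends pushout squares to pullback squares. -/
lemma isPullback_pre {A B X P : SSet.{0}} {f : A ⟶ X} {i : A ⟶ B} {inl : X ⟶ P} {inr : B ⟶ P}
    (sq : IsPushout f i inl inr) (K : SSet.{0}) :
    IsPullback ((MonoidalClosed.pre inr).app K) ((MonoidalClosed.pre inl).app K)
      ((MonoidalClosed.pre i).app K) ((MonoidalClosed.pre f).app K) := by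
  have sq' (Z : SSet.{0}) : IsPushout (f ▷ Z) (i ▷ Z) (inl ▷ Z) (inr ▷ Z) :=
    sq.map (tensorRight Z)
  refine ⟨⟨?_⟩, ⟨PullbackCone.IsLimit.mk _ (fun s => MonoidalClosed.curry ((sq' s.pt).desc
    (MonoidalClosed.uncurry s.snd) (MonoidalClosed.uncurry s.fst) ?_)) (fun s => ?_) (fun s => ?_)
    (fun s m h₁ h₂ => ?_)⟩⟩
  · rw [← NatTrans.comp_app, ← NatTrans.comp_app, ← MonoidalClosed.pre_map,
      ← MonoidalClosed.pre_map, sq.w]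
  · rw [← MonoidalClosed.uncurry_pre_app, ← MonoidalClosed.uncurry_pre_app, s.condition]
  · rw [MonoidalClosed.curry_pre_app, IsPushout.inr_desc, MonoidalClosed.curry_uncurry]
  · rw [MonoidalClosed.curry_pre_app, IsPushout.inl_desc, MonoidalClosed.curry_uncurry]
  · apply MonoidalClosed.uncurry_injective
    rw [MonoidalClosed.uncurry_curry]
    apply (sq' s.pt).hom_ext
    · rw [← MonoidalClosed.uncurry_pre_app, h₂, IsPushout.inl_desc]
    · rw [← MonoidalClosed.uncurry_pre_app, h₁, IsPushout.inr_desc]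

end Paper

/-- Left properness. The pushout of a weak homotopy equivalence
along a monomorphism is a weak homotopy equivalence. -/
theorem left_properness {A B X : SSet.{0}} (i : A ⟶ B) (f : A ⟶ X)
    (hi : Mono i) (hf : Paper.WeakHomotopyEquivalence f) :
    Paper.WeakHomotopyEquivalence (pushout.inr f i) := by
  intro K hK
  have := hK.isFibrant
  exact (hf K hK).of_isPullback (Paper.isPullback_pre (IsPushout.of_hasPushout f i) K)
    ((Paper.kanFibration_iff _).2 inferInstance)
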